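/- arXiv:2410.23498 — 6 statements merged into one kernel-verified Lean document; each statement's English description precedes it below -/
import Mathlib

section
/- Let Z be a nonempty set, H a real Hilbert space, and φ : Z → H a feature map; define the kernel k(z,z') := ⟪φ(z), φ(z')⟫_H. Fix points z_1,…,z_n ∈ Z and ρ > 0, and let α_n(z) := (K_n + ρI)⁻¹ k_n(z) and σ_n²(z) := k(z,z) − k_n(z)ᵀ(K_n + ρI)⁻¹ k_n(z). Then for every z ∈ Z, σ_n²(z) = sup over f ∈ H with ‖f‖_H ≤ 1 of (⟪f, φ(z)⟫ − Σ_{i=1}^n α_{n,i}(z) ⟪f, φ(z_i)⟫)², plus ρ · Σ_{i=1}^n α_{n,i}(z)²; equivalently, σ_n²(z) = ‖φ(z) − Σ_{i=1}^n α_{n,i}(z) φ(z_i)‖²_H + ρ ‖α_n(z)‖²_{ℓ²}. -/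
/- Kernel ridge regression setup: `Z` a nonempty set, `H` a real Hilbert space,
`φ : Z → H` a feature map, kernel `k(z,z') = ⟪φ z, φ z'⟫`. -/

open scoped RealInnerProductSpace
open Matrix

/-- The `n × n` kernel (Gram) matrix of the points `zs`. -/
noncomputable def gramM {Z H : Type*} [NormedAddCommGroup H] [InnerProductSpace ℝ H]
    (φ : Z → H) {n : ℕ} (zs : Fin n → Z) : Matrix (Fin n) (Fin n) ℝ :=
  Matrix.of fun i j => ⟪φ (zs i), φ (zs j)⟫

/-- The vector `k_n(z) = (k(z, z_1), …, k(z, z_n))`. -/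
noncomputable def kvec {Z H : Type*} [NormedAddCommGroup H] [InnerProductSpace ℝ H]
    (φ : Z → H) {n : ℕ} (zs : Fin n → Z) (z : Z) : Fin n → ℝ :=
  fun i => ⟪φ z, φ (zs i)⟫

/-- The kernel ridge regression weight vector `α_n(z) = (K_n + ρ I)⁻¹ k_n(z)`. -/
noncomputable def ridgeWeights {Z H : Type*} [NormedAddCommGroup H] [InnerProductSpace ℝ H]
    (φ : Z → H) {n : ℕ} (zs : Fin n → Z) (ρ : ℝ) (z : Z) : Fin n → ℝ :=
  (gramM φ zs + ρ • (1 : Matrix (Fin n) (Fin n) ℝ))⁻¹ *ᵥ kvec φ zs z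

/-- The kernel ridge uncertainty estimate
`σ_n²(z) = k(z,z) − k_n(z)ᵀ (K_n + ρ I)⁻¹ k_n(z)`. -/
noncomputable def ridgeVar {Z H : Type*} [NormedAddCommGroup H] [InnerProductSpace ℝ H]
    (φ : Z → H) {n : ℕ} (zs : Fin n → Z) (ρ : ℝ) (z : Z) : ℝ :=
  ⟪φ z, φ z⟫ -
    kvec φ zs z ⬝ᵥ ((gramM φ zs + ρ • (1 : Matrix (Fin n) (Fin n) ℝ))⁻¹ *ᵥ kvec φ zs z)

theorem iSup_sq_inner_unitBall {H : Type*} [NormedAddCommGroup H] [InnerProductSpace ℝ H]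
    (v : H) : ⨆ f : {f : H // ‖f‖ ≤ 1}, ⟪(f : H), v⟫ ^ 2 = ‖v‖ ^ 2 := by
  have bound (f : {f : H // ‖f‖ ≤ 1}) : ⟪(f : H), v⟫ ^ 2 ≤ ‖v‖ ^ 2 := by
    rw [sq_le_sq, abs_norm]
    exact (abs_real_inner_le_norm _ _).trans
      (mul_le_of_le_one_left (norm_nonneg v) f.2)
  have : Nonempty {f : H // ‖f‖ ≤ 1} := ⟨⟨0, by simp⟩⟩
  refine le_antisymm (ciSup_le bound) ?_
  have unit : ‖‖v‖⁻¹ • v‖ ≤ 1 := by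
    rw [norm_smul, norm_inv, norm_norm]
    exact inv_mul_le_one
  refine le_ciSup_of_le ⟨‖v‖ ^ 2, Set.forall_mem_range.2 bound⟩ ⟨_, unit⟩ (le_of_eq ?_)
  rcases eq_or_ne v 0 with rfl | hv
  · simp
  · have : ‖v‖ ≠ 0 := norm_ne_zero_iff.2 hv
    rw [real_inner_smul_left, real_inner_self_eq_norm_sq]
    field_simp

section

variable {Z H : Type*} [NormedAddCommGroup H] [InnerProductSpace ℝ H]
  (φ : Z → H) {n : ℕ} (zs : Fin n → Z)

theorem dotProduct_gramM_mulVec (x : Fin n → ℝ) :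
    x ⬝ᵥ (gramM φ zs *ᵥ x) = ‖∑ i, x i • φ (zs i)‖ ^ 2 := by
  rw [← real_inner_self_eq_norm_sq]
  exact star_dotProduct_gram_mulVec (𝕜 := ℝ) (φ ∘ zs) x x

theorem kvec_dotProduct (z : Z) (x : Fin n → ℝ) :
    kvec φ zs z ⬝ᵥ x = ⟪φ z, ∑ i, x i • φ (zs i)⟫ := by
  simp [kvec, dotProduct, inner_sum, real_inner_smul_right, mul_comm]

theorem isUnit_gramM_add_smul_one {ρ : ℝ} (hρ : 0 < ρ) :
    IsUnit (gramM φ zs + ρ • (1 : Matrix (Fin n) (Fin n) ℝ)) :=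
  (PosDef.posSemidef_add (posSemidef_gram ℝ (φ ∘ zs)) (PosDef.one.smul hρ)).isUnit

theorem gramM_mulVec_ridgeWeights_add {ρ : ℝ} (hρ : 0 < ρ) (z : Z) :
    gramM φ zs *ᵥ ridgeWeights φ zs ρ z + ρ • ridgeWeights φ zs ρ z = kvec φ zs z := by
  have h : (gramM φ zs + ρ • (1 : Matrix (Fin n) (Fin n) ℝ)) *ᵥ ridgeWeights φ zs ρ z =
      kvec φ zs z := by
    rw [ridgeWeights, mulVec_mulVec, mul_nonsing_inv _
      ((isUnit_iff_isUnit_det _).1 (isUnit_gramM_add_smul_one φ zs hρ)), one_mulVec]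
  rwa [add_mulVec, smul_mulVec, one_mulVec] at h

theorem ridgeVar_eq_norm_sq_add {ρ : ℝ} (hρ : 0 < ρ) (z : Z) :
    ridgeVar φ zs ρ z =
      ‖φ z - ∑ i, ridgeWeights φ zs ρ z i • φ (zs i)‖ ^ 2
        + ρ * ∑ i, ridgeWeights φ zs ρ z i ^ 2 := by
  have hvar : ridgeVar φ zs ρ z = ⟪φ z, φ z⟫ - kvec φ zs z ⬝ᵥ ridgeWeights φ zs ρ z := rfl
  have normal := congrArg (ridgeWeights φ zs ρ z ⬝ᵥ ·) (gramM_mulVec_ridgeWeights_add φ zs hρ z)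
  have hsq : ridgeWeights φ zs ρ z ⬝ᵥ ridgeWeights φ zs ρ z =
      ∑ i, ridgeWeights φ zs ρ z i ^ 2 := by
    simp [dotProduct, sq]
  simp only [dotProduct_add, dotProduct_smul, smul_eq_mul, dotProduct_gramM_mulVec, hsq,
    dotProduct_comm _ (kvec φ zs z), kvec_dotProduct] at normal
  rw [hvar, kvec_dotProduct, real_inner_self_eq_norm_sq, norm_sub_sq_real]
  linarith

end

/-- `σ_n²(z)` equals the supremum over unit-norm `f ∈ H` of the squared
noise-free prediction error, plus `ρ ‖α_n(z)‖²`; equivalently it equals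
`‖φ(z) − Σ_i α_{n,i}(z) φ(z_i)‖² + ρ ‖α_n(z)‖²`. -/
theorem ridgeVar_variational
    {Z H : Type*} [Nonempty Z] [NormedAddCommGroup H] [InnerProductSpace ℝ H]
    [CompleteSpace H]
    (φ : Z → H) {n : ℕ} (zs : Fin n → Z) (ρ : ℝ) (hρ : 0 < ρ) (z : Z) :
    ridgeVar φ zs ρ z =
      (⨆ f : {f : H // ‖f‖ ≤ 1},
        (⟪(f : H), φ z⟫ - ∑ i, ridgeWeights φ zs ρ z i * ⟪(f : H), φ (zs i)⟫) ^ 2)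
        + ρ * ∑ i, ridgeWeights φ zs ρ z i ^ 2
    ∧ ridgeVar φ zs ρ z =
      ‖φ z - ∑ i, ridgeWeights φ zs ρ z i • φ (zs i)‖ ^ 2
        + ρ * ∑ i, ridgeWeights φ zs ρ z i ^ 2 := by
  refine ⟨?_, ridgeVar_eq_norm_sq_add φ zs hρ z⟩
  rw [ridgeVar_eq_norm_sq_add φ zs hρ z, ← iSup_sq_inner_unitBall]
  simp only [inner_sub_right, inner_sum, real_inner_smul_right]
end

section
/- In the kernel ridge regression setup, for every f ∈ H and every z ∈ Z, the noise-free prediction error satisfies |⟪f, φ(z)⟫ − Σ_{i=1}^n α_{n,i}(z) ⟪f, φ(z_i)⟫| ≤ ‖f‖_H · σ_n(z), where σ_n(z) := √(σ_n²(z)). In particular, if ‖f‖_H ≤ C_f then the kernel ridge prediction of f from exact (noise-free) observations at z_1,…,z_n has error at most C_f σ_n(z) at every z. -/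
/- Kernel ridge regression setup: `Z` a nonempty set, `H` a real Hilbert space,
`φ : Z → H` a feature map, kernel `k(z,z') = ⟪φ z, φ z'⟫`. -/

open scoped RealInnerProductSpace
open Matrix

/-- The weights solve the regularised normal equations `K α + ρ α = k(z)`. -/
theorem gramM_mulVec_ridgeWeights {Z H : Type*} [NormedAddCommGroup H] [InnerProductSpace ℝ H]
    (φ : Z → H) {n : ℕ} (zs : Fin n → Z) {ρ : ℝ} (hρ : 0 < ρ) (z : Z) :
    gramM φ zs *ᵥ ridgeWeights φ zs ρ z + ρ • ridgeWeights φ zs ρ z = kvec φ zs z := by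
  have hpos : (gramM φ zs + ρ • (1 : Matrix (Fin n) (Fin n) ℝ)).PosDef :=
    (Matrix.PosDef.one.smul hρ).posSemidef_add (Matrix.posSemidef_gram ℝ fun i => φ (zs i))
  have hdet : IsUnit (gramM φ zs + ρ • (1 : Matrix (Fin n) (Fin n) ℝ)).det :=
    (Matrix.isUnit_iff_isUnit_det _).mp hpos.isUnit
  have h : (gramM φ zs + ρ • (1 : Matrix (Fin n) (Fin n) ℝ)) *ᵥ ridgeWeights φ zs ρ z
      = kvec φ zs z := by
    rw [ridgeWeights, Matrix.mulVec_mulVec, Matrix.mul_nonsing_inv _ hdet, Matrix.one_mulVec]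
  rwa [Matrix.add_mulVec, Matrix.smul_mulVec, Matrix.one_mulVec] at h

/-- The squared worst-case error of the weights falls short of the ridge variance by `ρ ‖α‖²`. -/
theorem norm_sub_sum_ridgeWeights_sq {Z H : Type*} [NormedAddCommGroup H] [InnerProductSpace ℝ H]
    (φ : Z → H) {n : ℕ} (zs : Fin n → Z) {ρ : ℝ} (hρ : 0 < ρ) (z : Z) :
    ‖φ z - ∑ i, ridgeWeights φ zs ρ z i • φ (zs i)‖ ^ 2
      = ridgeVar φ zs ρ z - ρ * (ridgeWeights φ zs ρ z ⬝ᵥ ridgeWeights φ zs ρ z) := by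
  have hvar : ridgeVar φ zs ρ z = ⟪φ z, φ z⟫ - kvec φ zs z ⬝ᵥ ridgeWeights φ zs ρ z := rfl
  have hk := congrArg (ridgeWeights φ zs ρ z ⬝ᵥ ·) (gramM_mulVec_ridgeWeights φ zs hρ z)
  simp only [dotProduct_add, dotProduct_smul, smul_eq_mul] at hk
  rw [dotProduct_comm _ (kvec φ zs z)] at hk
  rw [hvar]
  generalize ridgeWeights φ zs ρ z = a at hk ⊢
  have hcross : ⟪φ z, ∑ i, a i • φ (zs i)⟫ = kvec φ zs z ⬝ᵥ a := by
    simp [inner_sum, inner_smul_right, dotProduct, kvec, mul_comm]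
  have hquad : ‖∑ i, a i • φ (zs i)‖ ^ 2 = a ⬝ᵥ gramM φ zs *ᵥ a := by
    rw [← real_inner_self_eq_norm_sq, sum_inner]
    simp [inner_sum, inner_smul_left, inner_smul_right, dotProduct, mulVec, gramM,
      Finset.mul_sum, mul_comm, mul_left_comm]
  rw [norm_sub_sq_real, hcross, hquad, ← real_inner_self_eq_norm_sq]
  linarith

/-- The noise-free kernel ridge prediction error of `f ∈ H` at any `z`
is at most `‖f‖ σ_n(z)`; in particular, if `‖f‖ ≤ C_f` it is at most `C_f σ_n(z)`. -/
theorem ridge_noisefree_error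
    {Z H : Type*} [Nonempty Z] [NormedAddCommGroup H] [InnerProductSpace ℝ H]
    [CompleteSpace H]
    (φ : Z → H) {n : ℕ} (zs : Fin n → Z) (ρ : ℝ) (hρ : 0 < ρ) (Cf : ℝ) :
    (∀ (f : H) (z : Z),
      |⟪f, φ z⟫ - ∑ i, ridgeWeights φ zs ρ z i * ⟪f, φ (zs i)⟫|
        ≤ ‖f‖ * Real.sqrt (ridgeVar φ zs ρ z))
    ∧ (∀ f : H, ‖f‖ ≤ Cf → ∀ z : Z,
      |⟪f, φ z⟫ - ∑ i, ridgeWeights φ zs ρ z i * ⟪f, φ (zs i)⟫|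
        ≤ Cf * Real.sqrt (ridgeVar φ zs ρ z)) := by
  have key : ∀ (f : H) (z : Z),
      |⟪f, φ z⟫ - ∑ i, ridgeWeights φ zs ρ z i * ⟪f, φ (zs i)⟫|
        ≤ ‖f‖ * Real.sqrt (ridgeVar φ zs ρ z) := by
    intro f z
    have herr : ⟪f, φ z⟫ - ∑ i, ridgeWeights φ zs ρ z i * ⟪f, φ (zs i)⟫
        = ⟪f, φ z - ∑ i, ridgeWeights φ zs ρ z i • φ (zs i)⟫ := by
      simp [inner_sub_right, inner_sum, inner_smul_right]
    rw [herr]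
    refine (abs_real_inner_le_norm _ _).trans ?_
    gcongr
    apply Real.le_sqrt_of_sq_le
    rw [norm_sub_sum_ridgeWeights_sq φ zs hρ z]
    have hnonneg : 0 ≤ ridgeWeights φ zs ρ z ⬝ᵥ ridgeWeights φ zs ρ z :=
      Finset.sum_nonneg fun i _ => mul_self_nonneg _
    linarith [mul_nonneg hρ.le hnonneg]
  exact ⟨key, fun f hf z => (key f z).trans (by gcongr)⟩
end

section
/- In the kernel ridge regression setup, for every z ∈ Z the ℓ² norm of the weight vector is controlled by the uncertainty estimate: ρ · Σ_{i=1}^n α_{n,i}(z)² ≤ σ_n²(z); equivalently ‖α_n(z)‖_{ℓ²} ≤ σ_n(z)/√ρ. -/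
/- Kernel ridge regression setup: `Z` a nonempty set, `H` a real Hilbert space,
`φ : Z → H` a feature map, kernel `k(z,z') = ⟪φ z, φ z'⟫`. -/

open scoped RealInnerProductSpace
open Matrix

theorem gramM_eq_gram {Z H : Type*} [NormedAddCommGroup H] [InnerProductSpace ℝ H]
    (φ : Z → H) {n : ℕ} (zs : Fin n → Z) : gramM φ zs = gram ℝ (φ ∘ zs) := rfl

/-- The weight vector solves the normal equations `(K_n + ρ I) α_n(z) = k_n(z)`. -/
theorem gramM_add_smul_one_mulVec_ridgeWeights
    {Z H : Type*} [NormedAddCommGroup H] [InnerProductSpace ℝ H]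
    (φ : Z → H) {n : ℕ} (zs : Fin n → Z) {ρ : ℝ} (hρ : 0 < ρ) (z : Z) :
    (gramM φ zs + ρ • (1 : Matrix (Fin n) (Fin n) ℝ)) *ᵥ ridgeWeights φ zs ρ z
      = kvec φ zs z := by
  have hpd : (gramM φ zs + ρ • (1 : Matrix (Fin n) (Fin n) ℝ)).PosDef :=
    PosDef.posSemidef_add (posSemidef_gram ℝ (φ ∘ zs)) (PosDef.one.smul hρ)
  rw [ridgeWeights, mulVec_mulVec,
    mul_nonsing_inv _ ((isUnit_iff_isUnit_det _).mp hpd.isUnit), one_mulVec]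

/-- The uncertainty estimate splits into the squared residual of the ridge approximation of `φ z`
and the ridge penalty. -/
theorem ridgeVar_eq_norm_sub_sq_add {Z H : Type*} [NormedAddCommGroup H] [InnerProductSpace ℝ H]
    (φ : Z → H) {n : ℕ} (zs : Fin n → Z) {ρ : ℝ} (hρ : 0 < ρ) (z : Z) :
    ridgeVar φ zs ρ z = ‖φ z - ∑ i, ridgeWeights φ zs ρ z i • φ (zs i)‖ ^ 2
      + ρ * ∑ i, ridgeWeights φ zs ρ z i ^ 2 := by
  have hvar : ridgeVar φ zs ρ z = ⟪φ z, φ z⟫ - kvec φ zs z ⬝ᵥ ridgeWeights φ zs ρ z := rfl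
  have hsolve := gramM_add_smul_one_mulVec_ridgeWeights φ zs hρ z
  set a := ridgeWeights φ zs ρ z
  have hinner : kvec φ zs z ⬝ᵥ a = ⟪φ z, ∑ i, a i • φ (zs i)⟫ := by
    simp [dotProduct, kvec, inner_sum, inner_smul_right, mul_comm]
  have hgram := star_dotProduct_gram_mulVec (𝕜 := ℝ) (φ ∘ zs) a a
  have hnormal : kvec φ zs z ⬝ᵥ a
      = ⟪∑ i, a i • φ (zs i), ∑ i, a i • φ (zs i)⟫ + ρ * ∑ i, a i ^ 2 := by
    rw [← hsolve, dotProduct_comm, add_mulVec, dotProduct_add, smul_mulVec, one_mulVec,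
      dotProduct_smul, gramM_eq_gram]
    simp only [star_trivial, Function.comp_apply] at hgram
    rw [hgram, smul_eq_mul]
    simp [dotProduct, sq]
  rw [hvar, norm_sub_sq_real, ← real_inner_self_eq_norm_sq, ← real_inner_self_eq_norm_sq]
  linarith

/-- The ℓ² norm of the kernel ridge weight vector is controlled by the
uncertainty estimate: `ρ ⬝ Σ_i α_{n,i}(z)² ≤ σ_n²(z)`, equivalently
`‖α_n(z)‖_{ℓ²} ≤ σ_n(z)/√ρ`. -/
theorem ridgeWeights_l2_le
    {Z H : Type*} [Nonempty Z] [NormedAddCommGroup H] [InnerProductSpace ℝ H]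
    (φ : Z → H) {n : ℕ} (zs : Fin n → Z) (ρ : ℝ) (hρ : 0 < ρ) (z : Z) :
    ρ * ∑ i, ridgeWeights φ zs ρ z i ^ 2 ≤ ridgeVar φ zs ρ z
    ∧ Real.sqrt (∑ i, ridgeWeights φ zs ρ z i ^ 2)
        ≤ Real.sqrt (ridgeVar φ zs ρ z) / Real.sqrt ρ := by
  have hle : ρ * ∑ i, ridgeWeights φ zs ρ z i ^ 2 ≤ ridgeVar φ zs ρ z := by
    rw [ridgeVar_eq_norm_sub_sq_add φ zs hρ z]
    exact le_add_of_nonneg_left (sq_nonneg _)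
  refine ⟨hle, ?_⟩
  rw [← Real.sqrt_div' _ hρ.le]
  exact Real.sqrt_le_sqrt ((le_div_iff₀' hρ).mpr hle)
end

section
/- In the kernel ridge regression setup with a bounded kernel, i.e. k(z,z) ≤ 1 for all z ∈ Z, fix a sequence z_1,…,z_T ∈ Z and for each t let σ_t² denote the uncertainty estimate built from the first t points (σ_0²(z) = k(z,z)). Then Σ_{t=1}^{T} σ_{t-1}²(z_t) ≤ (2 / log(1 + 1/ρ)) · (1/2) log det(I + ρ⁻¹ K_T), where K_T is the kernel matrix of z_1,…,z_T. -/
/- Kernel ridge regression setup: `Z` a nonempty set, `H` a real Hilbert space,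
`φ : Z → H` a feature map, kernel `k(z,z') = ⟪φ z, φ z'⟫`. -/

open scoped RealInnerProductSpace
open Matrix

section RidgeVariance

variable {Z H : Type*} [NormedAddCommGroup H] [InnerProductSpace ℝ H]
  (φ : Z → H) {n : ℕ} (zs : Fin n → Z) {ρ : ℝ}

/-- The regularized kernel matrix is positive definite. -/
lemma posDef_gramM_add_smul_one (hρ : 0 < ρ) :
    (gramM φ zs + ρ • (1 : Matrix (Fin n) (Fin n) ℝ)).PosDef :=
  PosDef.posSemidef_add (posSemidef_gram ℝ fun i => φ (zs i)) (PosDef.one.smul hρ)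

lemma ridgeVar_le_inner_self (hρ : 0 < ρ) (z : Z) :
    ridgeVar φ zs ρ z ≤ ⟪φ z, φ z⟫ := by
  have h := (posDef_gramM_add_smul_one φ zs hρ).inv.posSemidef.dotProduct_mulVec_nonneg
    (kvec φ zs z)
  rw [star_trivial] at h
  exact sub_le_self _ h

/-- The ridge variance is the minimal value of the ridge objective
`‖φ z - ∑ i, α i • φ (z i)‖² + ρ ‖α‖²`. -/
lemma ridgeVar_eq (hρ : 0 < ρ) (z : Z) :
    ridgeVar φ zs ρ z = ‖φ z - ∑ i, ridgeWeights φ zs ρ z i • φ (zs i)‖ ^ 2 +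
      ρ * (ridgeWeights φ zs ρ z ⬝ᵥ ridgeWeights φ zs ρ z) := by
  set α := ridgeWeights φ zs ρ z with hα
  have hdet := (posDef_gramM_add_smul_one φ zs hρ).isUnit.map Matrix.detMonoidHom
  have hsolve : (gramM φ zs + ρ • (1 : Matrix (Fin n) (Fin n) ℝ)) *ᵥ α = kvec φ zs z := by
    rw [hα, ridgeWeights, mulVec_mulVec, mul_nonsing_inv _ hdet, one_mulVec]
  have hquad : α ⬝ᵥ (gramM φ zs *ᵥ α) =
      ‖∑ i, α i • φ (zs i)‖ ^ 2 := by
    rw [← real_inner_self_eq_norm_sq]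
    exact star_dotProduct_gram_mulVec (𝕜 := ℝ) (fun i => φ (zs i)) α α
  have hcross : ⟪φ z, ∑ i, α i • φ (zs i)⟫ = kvec φ zs z ⬝ᵥ α := by
    simp [inner_sum, inner_smul_right, dotProduct, kvec, mul_comm]
  have hdot := congrArg (α ⬝ᵥ ·) hsolve
  simp only [add_mulVec, smul_mulVec, one_mulVec, dotProduct_add, dotProduct_smul,
    smul_eq_mul, hquad, dotProduct_comm α (kvec φ zs z)] at hdot
  have hvar : ridgeVar φ zs ρ z = ⟪φ z, φ z⟫ - kvec φ zs z ⬝ᵥ α := rfl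
  rw [hvar, norm_sub_sq_real, hcross, real_inner_self_eq_norm_sq]
  linarith

lemma ridgeVar_nonneg (hρ : 0 < ρ) (z : Z) : 0 ≤ ridgeVar φ zs ρ z := by
  rw [ridgeVar_eq φ zs hρ]
  have h := dotProduct_star_self_nonneg (ridgeWeights φ zs ρ z)
  rw [star_trivial] at h
  positivity

/-- Adding a point multiplies the determinant of the regularized kernel matrix by its
Schur complement. -/
lemma det_gramM_add_smul_one_succ (hρ : 0 < ρ) (zs : Fin (n + 1) → Z) :
    (gramM φ zs + ρ • (1 : Matrix (Fin (n + 1)) (Fin (n + 1)) ℝ)).det =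
      (gramM φ (fun i : Fin n => zs i.castSucc) + ρ • (1 : Matrix (Fin n) (Fin n) ℝ)).det *
        (ρ + ridgeVar φ (fun i : Fin n => zs i.castSucc) ρ (zs (Fin.last n))) := by
  set zs' : Fin n → Z := fun i => zs i.castSucc
  set k := kvec φ zs' (zs (Fin.last n)) with hk
  set A := gramM φ zs' + ρ • (1 : Matrix (Fin n) (Fin n) ℝ) with hA
  have hunit : IsUnit A := (posDef_gramM_add_smul_one φ zs' hρ).isUnit
  let _ : Invertible A := hunit.invertible
  have hblocks : (gramM φ zs + ρ • (1 : Matrix (Fin (n + 1)) (Fin (n + 1)) ℝ)).submatrix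
      finSumFinEquiv finSumFinEquiv =
      fromBlocks A (replicateCol (Fin 1) k) (replicateRow (Fin 1) k)
        (of fun _ _ => ⟪φ (zs (Fin.last n)), φ (zs (Fin.last n))⟫ + ρ) := by
    have hcast (i : Fin n) : Fin.castAdd 1 i = i.castSucc := rfl
    have hlast (i : Fin 1) : Fin.natAdd n i = Fin.last n := by ext; simp
    ext (i | i) (j | j)
    · simp [hA, gramM, zs', one_apply, hcast]
    · simpa [hk, gramM, kvec, zs', one_apply, hcast, hlast, Fin.castSucc_ne_last] using
        real_inner_comm _ _
    · simp [hk, gramM, kvec, zs', one_apply, hcast, hlast, (Fin.castSucc_ne_last _).symm]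
    · simp [gramM, hlast]
  rw [← det_submatrix_equiv_self finSumFinEquiv, hblocks, det_fromBlocks₁₁, det_fin_one,
    invOf_eq_nonsing_inv, Matrix.mul_assoc, ← replicateCol_mulVec]
  have hentry : (replicateRow (Fin 1) k * replicateCol (Fin 1) (A⁻¹ *ᵥ k)) 0 0 =
      k ⬝ᵥ (A⁻¹ *ᵥ k) := rfl
  rw [Matrix.sub_apply, hentry, of_apply, ridgeVar]
  ring

lemma det_one_add_inv_smul_gramM (hρ : ρ ≠ 0) :
    (1 + ρ⁻¹ • gramM φ zs).det =
      ρ⁻¹ ^ n * (gramM φ zs + ρ • (1 : Matrix (Fin n) (Fin n) ℝ)).det := by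
  have h : 1 + ρ⁻¹ • gramM φ zs =
      ρ⁻¹ • (gramM φ zs + ρ • (1 : Matrix (Fin n) (Fin n) ℝ)) := by
    rw [smul_add, smul_smul, inv_mul_cancel₀ hρ, one_smul, add_comm]
  rw [h, det_smul, Fintype.card_fin]

/-- The information gain is the sum of the logarithms of the normalized ridge variances. -/
lemma log_det_one_add_inv_smul_gramM (hρ : 0 < ρ) (zseq : ℕ → Z) (T : ℕ) :
    Real.log (1 + ρ⁻¹ • gramM φ (fun i : Fin T => zseq i)).det =
      ∑ t ∈ Finset.range T,
        Real.log (1 + ridgeVar φ (fun i : Fin t => zseq i) ρ (zseq t) / ρ) := by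
  induction T with
  | zero => simp
  | succ t ih =>
    have hs := ridgeVar_nonneg φ (fun i : Fin t => zseq i) hρ (zseq t)
    have hstep : (1 + ρ⁻¹ • gramM φ (fun i : Fin (t + 1) => zseq i)).det =
        (1 + ρ⁻¹ • gramM φ (fun i : Fin t => zseq i)).det *
          (1 + ridgeVar φ (fun i : Fin t => zseq i) ρ (zseq t) / ρ) := by
      rw [det_one_add_inv_smul_gramM φ _ hρ.ne', det_one_add_inv_smul_gramM φ _ hρ.ne',
        det_gramM_add_smul_one_succ φ hρ]
      simp only [Fin.val_castSucc, Fin.val_last]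
      rw [pow_succ]
      field_simp
    have hdet : (1 + ρ⁻¹ • gramM φ (fun i : Fin t => zseq i)).det ≠ 0 := by
      rw [det_one_add_inv_smul_gramM φ _ hρ.ne']
      have := (posDef_gramM_add_smul_one φ (fun i : Fin t => zseq i) hρ).det_pos
      positivity
    rw [hstep, Real.log_mul hdet (by positivity), ih, Finset.sum_range_succ]

end RidgeVariance

/-- The chord bound for the concave function `s ↦ log (1 + c s)` on `[0, 1]`. -/
lemma mul_log_one_add_le_log_one_add_mul {c s : ℝ} (hc : 0 ≤ c) (hs₀ : 0 ≤ s) (hs₁ : s ≤ 1) :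
    s * Real.log (1 + c) ≤ Real.log (1 + s * c) := by
  rw [← Real.log_rpow (by positivity)]
  exact Real.log_le_log (by positivity)
    (rpow_one_add_le_one_add_mul_self (by linarith) hs₀ hs₁)

/-- (Elliptical potential / information-gain bound, Srinivas et al.)
For a bounded kernel (`k(z,z) ≤ 1`), the sum of sequential posterior variances is at
most `(2/log(1+1/ρ))` times the information gain `(1/2) log det(I + ρ⁻¹ K_T)`.
The sequence is 0-indexed: `zseq t` is the paper's `z_{t+1}`, so
`σ_{t-1}²(z_t)` is `ridgeVar φ (fun i : Fin t => zseq i) ρ (zseq t)`. -/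
theorem sum_ridgeVar_le_infogain
    {Z H : Type*} [Nonempty Z] [NormedAddCommGroup H] [InnerProductSpace ℝ H]
    (φ : Z → H) (ρ : ℝ) (hρ : 0 < ρ)
    (hk : ∀ z : Z, ⟪φ z, φ z⟫ ≤ 1)
    (T : ℕ) (zseq : ℕ → Z) :
    ∑ t ∈ Finset.range T, ridgeVar φ (fun i : Fin t => zseq i) ρ (zseq t)
      ≤ (2 / Real.log (1 + 1 / ρ)) *
        ((1 / 2) * Real.log ((1 + ρ⁻¹ • gramM φ (fun i : Fin T => zseq i)).det)) := by
  have hL : 0 < Real.log (1 + 1 / ρ) := Real.log_pos (by simpa using hρ)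
  rw [log_det_one_add_inv_smul_gramM φ hρ, ← mul_assoc,
    show 2 / Real.log (1 + 1 / ρ) * (1 / 2) = (Real.log (1 + 1 / ρ))⁻¹ by ring, Finset.mul_sum]
  refine Finset.sum_le_sum fun t _ => ?_
  rw [le_inv_mul_iff₀ hL, mul_comm]
  simpa only [mul_one_div] using mul_log_one_add_le_log_one_add_mul (one_div_nonneg.2 hρ.le)
    (ridgeVar_nonneg φ _ hρ _) ((ridgeVar_le_inner_self φ _ hρ _).trans (hk _))
end

section
/- Assume the Bellman optimality equation holds: there exist J* ∈ ℝ and bounded measurable functions v* : S → ℝ and q* : S×A → ℝ such that for all s ∈ S and a ∈ A, J* + q*(s,a) = r(s,a) + [Pv*](s,a) and v*(s) = max_{a∈A} q*(s,a). Then for every w ∈ ℕ and every s ∈ S, |w · J* − V*_w(s)| ≤ span(v*), where span(v*) := sup_{s,s' ∈ S} |v*(s) − v*(s')|. -/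
/- MDP setup: `S` a measurable state space, `A` a nonempty finite action set,
`r : S × A → [0,1]` a measurable reward, `P` a Markov kernel from `S × A` to `S`.
For bounded measurable `v : S → ℝ`, `[Pv](s,a) = ∫ v(s') dP(s'|s,a)`. -/

open MeasureTheory ProbabilityTheory

/-- The optimal `j`-step value functions: `V*_0 ≡ 0` and
`V*_{j+1}(s) = max_a (r(s,a) + [P V*_j](s,a))`. -/
noncomputable def Vstar {S A : Type*} [MeasurableSpace S] [MeasurableSpace A] [Fintype A] [Nonempty A]
    (P : Kernel (S × A) S) (r : S × A → ℝ) : ℕ → S → ℝ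
  | 0 => fun _ => 0
  | j + 1 => fun s => ⨆ a : A, (r (s, a) + ∫ s', Vstar P r j s' ∂(P (s, a)))

section

variable {S A : Type*} [MeasurableSpace S] [MeasurableSpace A] [Fintype A] [Nonempty A]
  {r : S × A → ℝ} {P : Kernel (S × A) S}

theorem Vstar_succ (j : ℕ) (s : S) :
    Vstar P r (j + 1) s = ⨆ a : A, (r (s, a) + ∫ s', Vstar P r j s' ∂(P (s, a))) := rfl

theorem measurable_Vstar [IsMarkovKernel P] (hr : Measurable r) (j : ℕ) :
    Measurable (Vstar P r j) := by
  induction j with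
  | zero => exact measurable_const
  | succ j ih =>
    refine Measurable.iSup fun a => ?_
    have hPV : Measurable fun z : S × A => ∫ s', Vstar P r j s' ∂(P z) :=
      (ih.stronglyMeasurable.integral_kernel (κ := P)).measurable
    exact (hr.add hPV).comp measurable_prodMk_right

theorem Vstar_mem_Icc [IsMarkovKernel P] (hr01 : ∀ z, r z ∈ Set.Icc (0 : ℝ) 1) (j : ℕ) (s : S) :
    Vstar P r j s ∈ Set.Icc (0 : ℝ) j := by
  induction j generalizing s with
  | zero => simp [Vstar]
  | succ j ih =>
    rw [Vstar_succ]
    refine ⟨Real.iSup_nonneg fun a => add_nonneg (hr01 _).1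
      (integral_nonneg fun s' => (ih s').1), ciSup_le fun a => ?_⟩
    have hle : ∫ s', Vstar P r j s' ∂(P (s, a)) ≤ ∫ _, (j : ℝ) ∂(P (s, a)) :=
      integral_mono_of_nonneg (.of_forall fun s' => (ih s').1) (integrable_const _)
        (.of_forall fun s' => (ih s').2)
    rw [integral_const, probReal_univ, one_smul] at hle
    push_cast
    linarith [(hr01 (s, a)).2]

theorem integrable_Vstar [IsMarkovKernel P] (hr : Measurable r)
    (hr01 : ∀ z, r z ∈ Set.Icc (0 : ℝ) 1) (j : ℕ) (μ : Measure S) [IsFiniteMeasure μ] :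
    Integrable (Vstar P r j) μ := by
  refine Integrable.of_bound (measurable_Vstar hr j).aestronglyMeasurable (j : ℝ)
    (.of_forall fun s => ?_)
  have h := Vstar_mem_Icc (P := P) hr01 j s
  rw [Real.norm_eq_abs, abs_of_nonneg h.1]
  exact h.2

/-- A solution `(J, v, q)` of the Bellman optimality equation with `m ≤ v ≤ M` sandwiches the
finite-horizon values: `w J + v - M ≤ V*_w ≤ w J + v - m`. -/
theorem Vstar_mem_Icc_of_bellman [IsMarkovKernel P] (hr : Measurable r)
    (hr01 : ∀ z, r z ∈ Set.Icc (0 : ℝ) 1) {J m M : ℝ} {v : S → ℝ} {q : S × A → ℝ}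
    (hv : Measurable v) (hm : ∀ s, m ≤ v s) (hM : ∀ s, v s ≤ M)
    (hBellman : ∀ s a, J + q (s, a) = r (s, a) + ∫ s', v s' ∂(P (s, a)))
    (hvmax : ∀ s, v s = ⨆ a : A, q (s, a)) (w : ℕ) (s : S) :
    Vstar P r w s ∈ Set.Icc (w * J + v s - M) (w * J + v s - m) := by
  induction w generalizing s with
  | zero => simp [Vstar, hm s, hM s]
  | succ w ih =>
    have hvint (a : A) : Integrable v (P (s, a)) :=
      Integrable.of_mem_Icc m M hv.aemeasurable (.of_forall fun s' => ⟨hm s', hM s'⟩)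
    have hVint (a : A) : Integrable (Vstar P r w) (P (s, a)) := integrable_Vstar hr hr01 w _
    have hadd (a : A) : Integrable (fun s' => w * J + v s') (P (s, a)) :=
      (integrable_const _).add (hvint a)
    have hshift (a : A) (c : ℝ) : ∫ s', (w * J + v s' - c) ∂(P (s, a)) =
        w * J + ∫ s', v s' ∂(P (s, a)) - c := by
      rw [integral_sub (hadd a) (integrable_const _),
        integral_add (integrable_const _) (hvint a)]
      simp
    have hshiftInt (a : A) (c : ℝ) : Integrable (fun s' => w * J + v s' - c) (P (s, a)) :=
      (hadd a).sub (integrable_const _)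
    have hlower (a : A) := integral_mono (hshiftInt a M) (hVint a) fun s' => (ih s').1
    have hupper (a : A) := integral_mono (hVint a) (hshiftInt a m) fun s' => (ih s').2
    simp only [hshift] at hlower hupper
    rw [Vstar_succ]
    push_cast
    constructor
    · have hq : v s ≤ (⨆ a : A, (r (s, a) + ∫ s', Vstar P r w s' ∂(P (s, a)))) -
          ((w + 1) * J - M) := by
        rw [hvmax s]
        refine ciSup_le fun a => ?_
        have hsup := le_ciSup (Set.finite_range fun a : A =>
          r (s, a) + ∫ s', Vstar P r w s' ∂(P (s, a))).bddAbove a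
        linarith [hlower a, hBellman s a]
      linarith
    · refine ciSup_le fun a => ?_
      have hq : q (s, a) ≤ v s := by
        rw [hvmax s]
        exact le_ciSup (Set.finite_range fun a : A => q (s, a)).bddAbove a
      linarith [hupper a, hBellman s a]

end

/-- Under the Bellman optimality equation, for every window size `w`
and every state `s`, `|w J* − V*_w(s)| ≤ span(v*)`, where
`span(v*) = sup_{s,s'} |v*(s) − v*(s')|`. -/
theorem avg_reward_window_span_bound
    {S A : Type*} [MeasurableSpace S] [MeasurableSpace A] [Fintype A] [Nonempty A]
    (r : S × A → ℝ) (hr_meas : Measurable r) (hr01 : ∀ z, r z ∈ Set.Icc (0 : ℝ) 1)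
    (P : Kernel (S × A) S) [IsMarkovKernel P]
    (Jstar : ℝ) (vstar : S → ℝ) (qstar : S × A → ℝ)
    (hv_meas : Measurable vstar) (hq_meas : Measurable qstar)
    (Cb : ℝ) (hv_bdd : ∀ s, |vstar s| ≤ Cb) (hq_bdd : ∀ z, |qstar z| ≤ Cb)
    (hBellman : ∀ s a, Jstar + qstar (s, a) = r (s, a) + ∫ s', vstar s' ∂(P (s, a)))
    (hvmax : ∀ s, vstar s = ⨆ a : A, qstar (s, a)) :
    ∀ (w : ℕ) (s : S),
      |(w : ℝ) * Jstar - Vstar P r w s| ≤ ⨆ p : S × S, |vstar p.1 - vstar p.2| := by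
  intro w s
  have hbdd : BddAbove (Set.range fun p : S × S => |vstar p.1 - vstar p.2|) := by
    refine ⟨Cb + Cb, ?_⟩
    rintro _ ⟨p, rfl⟩
    exact (abs_sub _ _).trans (add_le_add (hv_bdd _) (hv_bdd _))
  have hspan (s' : S) :
      -(⨆ p : S × S, |vstar p.1 - vstar p.2|) ≤ vstar s' - vstar s ∧
        vstar s' - vstar s ≤ ⨆ p : S × S, |vstar p.1 - vstar p.2| :=
    abs_le.mp (le_ciSup hbdd (s', s))
  have h := Vstar_mem_Icc_of_bellman hr_meas hr01 hv_meas
    (m := vstar s - ⨆ p : S × S, |vstar p.1 - vstar p.2|)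
    (M := vstar s + ⨆ p : S × S, |vstar p.1 - vstar p.2|)
    (fun s' => by linarith [(hspan s').1]) (fun s' => by linarith [(hspan s').2])
    hBellman hvmax w s
  rw [abs_le]
  constructor <;> linarith [h.1, h.2]
end

section
/- Fix w ∈ ℕ, w ≥ 1, β ≥ 0, a function σ : S×A → [0,∞), states s_1,…,s_{w+1} ∈ S, actions a_1,…,a_w ∈ A, and bounded measurable functions q_1,…,q_w : S×A → ℝ, v_1,…,v_{w+1} : S → ℝ with v_{w+1} ≡ 0 and v_t(s) = max_{a∈A} q_t(s,a) for all t ≤ w. Suppose a_t attains the maximum: q_t(s_t, a_t) = v_t(s_t), and suppose the upper-confidence condition q_t(z) ≤ r(z) + [P v_{t+1}](z) + 2β σ(z) holds for all z ∈ S×A and t ≤ w. Let π_t : S → A be measurable selectors with π_t(s) attaining max_{a} q_t(s,a) and π_t(s_t) = a_t, and define the nonstationary rollout values W_{w+1} ≡ 0 and W_t(s) := r(s, π_t(s)) + [P W_{t+1}](s, π_t(s)) for t = w down to 1. Then, writing z_t := (s_t, a_t), v_1(s_1) − W_1(s_1) ≤ Σ_{t=1}^{w} 2β σ(z_t) + Σ_{t=1}^{w}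 ( [P v_{t+1}](z_t) − v_{t+1}(s_{t+1}) ) + Σ_{t=1}^{w} ( W_{t+1}(s_{t+1}) − [P W_{t+1}](z_t) ). -/
/- MDP setup: `S` a measurable state space, `A` a nonempty finite action set,
`r : S × A → [0,1]` a measurable reward, `P` a Markov kernel from `S × A` to `S`.
For bounded measurable `v : S → ℝ`, `[Pv](s,a) = ∫ v(s') dP(s'|s,a)`.
Indexing is 1-based: `sstate t` is `s_t` for `1 ≤ t ≤ w+1`, `act t` is `a_t`. -/

open MeasureTheory ProbabilityTheory

theorem sum_Icc_one_sub_succ {G : Type*} [AddCommGroup G] (f : ℕ → G) (n : ℕ) :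
    ∑ t ∈ Finset.Icc 1 n, (f t - f (t + 1)) = f 1 - f (n + 1) := by
  induction n with
  | zero => simp
  | succ n ih => rw [Finset.sum_Icc_succ_top (by omega), ih, sub_add_sub_cancel]

/-- (Per-window regret decomposition for KUCB-RL.) With `v_{w+1} ≡ 0`,
`v_t(s) = max_a q_t(s,a)`, actions `a_t` greedy for `q_t`, the upper-confidence
condition `q_t(z) ≤ r(z) + [P v_{t+1}](z) + 2βσ(z)`, measurable greedy selectors
`π_t` with `π_t(s_t) = a_t`, and the nonstationary rollout values `W_{w+1} ≡ 0`,
`W_t(s) = r(s, π_t(s)) + [P W_{t+1}](s, π_t(s))`, one has (with `z_t = (s_t, a_t)`):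
`v_1(s_1) − W_1(s_1) ≤ Σ_t 2βσ(z_t) + Σ_t ([P v_{t+1}](z_t) − v_{t+1}(s_{t+1}))
+ Σ_t (W_{t+1}(s_{t+1}) − [P W_{t+1}](z_t))`. -/
theorem per_window_regret_decomposition
    {S A : Type*} [MeasurableSpace S] [MeasurableSpace A] [Fintype A] [Nonempty A]
    (r : S × A → ℝ) (hr_meas : Measurable r) (hr01 : ∀ z, r z ∈ Set.Icc (0 : ℝ) 1)
    (P : Kernel (S × A) S) [IsMarkovKernel P]
    (w : ℕ) (hw : 1 ≤ w) (β : ℝ) (hβ : 0 ≤ β)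
    (σ : S × A → ℝ) (hσ : ∀ z, 0 ≤ σ z)
    (sstate : ℕ → S) (act : ℕ → A)
    (q : ℕ → S × A → ℝ) (v : ℕ → S → ℝ)
    (hq_meas : ∀ t, 1 ≤ t → t ≤ w → Measurable (q t))
    (hv_meas : ∀ t, 1 ≤ t → t ≤ w + 1 → Measurable (v t))
    (Cb : ℝ)
    (hq_bdd : ∀ t, 1 ≤ t → t ≤ w → ∀ z, |q t z| ≤ Cb)
    (hv_bdd : ∀ t, 1 ≤ t → t ≤ w + 1 → ∀ s, |v t s| ≤ Cb)
    (hv_top : ∀ s, v (w + 1) s = 0)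
    (hv_max : ∀ t, 1 ≤ t → t ≤ w → ∀ s, v t s = ⨆ a : A, q t (s, a))
    (hgreedy : ∀ t, 1 ≤ t → t ≤ w → q t (sstate t, act t) = v t (sstate t))
    (hucb : ∀ t, 1 ≤ t → t ≤ w → ∀ z : S × A,
      q t z ≤ r z + (∫ s', v (t + 1) s' ∂(P z)) + 2 * β * σ z)
    (π : ℕ → S → A)
    (hπ_meas : ∀ t, 1 ≤ t → t ≤ w → Measurable (π t))
    (hπ_max : ∀ t, 1 ≤ t → t ≤ w → ∀ s, q t (s, π t s) = ⨆ a : A, q t (s, a))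
    (hπ_act : ∀ t, 1 ≤ t → t ≤ w → π t (sstate t) = act t)
    (W : ℕ → S → ℝ)
    (hW_top : ∀ s, W (w + 1) s = 0)
    (hW : ∀ t, 1 ≤ t → t ≤ w → ∀ s,
      W t s = r (s, π t s) + ∫ s', W (t + 1) s' ∂(P (s, π t s))) :
    v 1 (sstate 1) - W 1 (sstate 1)
      ≤ (∑ t ∈ Finset.Icc 1 w, 2 * β * σ (sstate t, act t))
        + (∑ t ∈ Finset.Icc 1 w,
            ((∫ s', v (t + 1) s' ∂(P (sstate t, act t))) - v (t + 1) (sstate (t + 1))))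
        + (∑ t ∈ Finset.Icc 1 w,
            (W (t + 1) (sstate (t + 1)) - ∫ s', W (t + 1) s' ∂(P (sstate t, act t)))) := by
  have hstep : ∀ t ∈ Finset.Icc 1 w,
      (v t (sstate t) - W t (sstate t))
          - (v (t + 1) (sstate (t + 1)) - W (t + 1) (sstate (t + 1)))
        ≤ 2 * β * σ (sstate t, act t)
          + ((∫ s', v (t + 1) s' ∂(P (sstate t, act t))) - v (t + 1) (sstate (t + 1)))
          + (W (t + 1) (sstate (t + 1)) - ∫ s', W (t + 1) s' ∂(P (sstate t, act t))) := by
    intro t ht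
    obtain ⟨h1, h2⟩ := Finset.mem_Icc.mp ht
    have hWt := hW t h1 h2 (sstate t)
    rw [hπ_act t h1 h2] at hWt
    linarith [hucb t h1 h2 (sstate t, act t), hgreedy t h1 h2]
  have hsum := Finset.sum_le_sum hstep
  rw [sum_Icc_one_sub_succ (fun t => v t (sstate t) - W t (sstate t)) w,
    Finset.sum_add_distrib, Finset.sum_add_distrib] at hsum
  simpa only [hv_top, hW_top, sub_zero] using hsum
end
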